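/- arXiv:2409.16866 — 5 statements merged into one kernel-verified Lean document; each statement's English description precedes it below -/
import Mathlib

section
/- Let U > 0 and α ∈ (0,1]. Let X and Y be real random variables (possibly on different probability spaces) taking values in [0, U], with cumulative distribution functions F(y) = P(X ≤ y) and G(y) = P(Y ≤ y). Then |CVaR_α[X] − CVaR_α[Y]| ≤ (U/α) · sup_{y∈ℝ} |F(y) − G(y)|. -/
open MeasureTheory

/-- Conditional Value at Risk at level `α` of the random variable `Y` on the
probability space `(Ω, P)`, via the Rockafellar–Uryasev formula
`CVaR_α[Y] = inf_t ( t + (1/α) 𝔼[max (Y - t) 0] )`. -/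
noncomputable def cvar {Ω : Type*} [MeasurableSpace Ω] (P : Measure Ω) (α : ℝ)
    (Y : Ω → ℝ) : ℝ :=
  ⨅ t : ℝ, t + (1 / α) * ∫ ω, max (Y ω - t) 0 ∂P

lemma integrable_max_sub_zero {Ω : Type*} [MeasurableSpace Ω] (P : Measure Ω)
    [IsFiniteMeasure P] {X : Ω → ℝ} {U : ℝ} (hX : Measurable X)
    (hXU : ∀ ω, X ω ∈ Set.Icc 0 U) (t : ℝ) :
    Integrable (fun ω => max (X ω - t) 0) P := by
  refine Integrable.of_bound (C := U + |t|) (by fun_prop) (ae_of_all _ fun ω => ?_)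
  obtain ⟨h0, h1⟩ := hXU ω
  rw [Real.norm_of_nonneg (le_max_right _ _)]
  exact max_le (by linarith [neg_abs_le t]) (by linarith [abs_nonneg t])

/-- Layer-cake formula: the expected excess over `t` is the integral of the upper tail. -/
lemma integral_max_sub_zero_eq {Ω : Type*} [MeasurableSpace Ω] (P : Measure Ω)
    [IsProbabilityMeasure P] {X : Ω → ℝ} {U : ℝ} (hX : Measurable X)
    (hXU : ∀ ω, X ω ∈ Set.Icc 0 U) {t : ℝ} (ht : 0 ≤ t) :
    ∫ ω, max (X ω - t) 0 ∂P = ∫ s in Set.Ioc 0 U, (1 - P.real {ω | X ω ≤ t + s}) := by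
  rw [(integrable_max_sub_zero P hX hXU t).integral_eq_integral_meas_lt
    (ae_of_all _ fun ω => le_max_right _ _)]
  have tail : ∀ s ∈ Set.Ioi (0 : ℝ),
      P.real {ω | s < max (X ω - t) 0} = 1 - P.real {ω | X ω ≤ t + s} := by
    intro s hs
    rw [← probReal_compl_eq_one_sub (measurableSet_le hX measurable_const)]
    congr 1
    ext ω
    simp only [Set.mem_ofPred_eq, Set.mem_compl_iff, not_le, lt_max_iff]
    have hs' : 0 < s := hs
    constructor
    · rintro (h | h) <;> linarith
    · intro h
      left
      linarith
  rw [setIntegral_congr_fun measurableSet_Ioi tail]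
  refine setIntegral_eq_of_subset_of_forall_sdiff_eq_zero measurableSet_Ioi
    Set.Ioc_subset_Ioi_self fun s hs => ?_
  have hs0 : 0 < s := hs.1
  have hsU : U < s := by
    by_contra! h
    exact hs.2 ⟨hs0, h⟩
  have : {ω | X ω ≤ t + s} = Set.univ :=
    Set.eq_univ_of_forall fun ω => by
      have := (hXU ω).2
      simp only [Set.mem_ofPred_eq]
      linarith
  simp [this]

lemma integrableOn_one_sub_cdf {Ω : Type*} [MeasurableSpace Ω] (P : Measure Ω)
    [IsProbabilityMeasure P] (X : Ω → ℝ) (t U : ℝ) :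
    IntegrableOn (fun s => 1 - P.real {ω | X ω ≤ t + s}) (Set.Ioc 0 U) := by
  have anti : Antitone fun s => 1 - P.real {ω | X ω ≤ t + s} := fun a b hab =>
    sub_le_sub_left (measureReal_mono fun ω (hω : X ω ≤ t + a) =>
      show X ω ≤ t + b by linarith) 1
  exact (anti.locallyIntegrable.integrableOn_isCompact isCompact_Icc).mono_set
    Set.Ioc_subset_Icc_self

lemma integral_max_sub_of_nonpos {Ω : Type*} [MeasurableSpace Ω] (P : Measure Ω)
    [IsProbabilityMeasure P] {X : Ω → ℝ} {U : ℝ} (hX : Measurable X)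
    (hXU : ∀ ω, X ω ∈ Set.Icc 0 U) {t : ℝ} (ht : t ≤ 0) :
    ∫ ω, max (X ω - t) 0 ∂P = ∫ ω, max (X ω - 0) 0 ∂P - t := by
  have pointwise : ∀ ω, max (X ω - t) 0 = max (X ω - 0) 0 - t := fun ω => by
    have := (hXU ω).1
    rw [max_eq_left (by linarith), max_eq_left (by linarith), sub_zero]
  simp_rw [pointwise]
  rw [integral_sub (integrable_max_sub_zero P hX hXU 0) (integrable_const t)]
  simp

/-- The expected excesses of two `[0, U]`-valued variables over a common threshold differ by at
most `U` times any uniform bound on the difference of the distribution functions. -/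
lemma abs_integral_max_sub_le {Ω₁ Ω₂ : Type*} [MeasurableSpace Ω₁] [MeasurableSpace Ω₂]
    (P : Measure Ω₁) (Q : Measure Ω₂) [IsProbabilityMeasure P] [IsProbabilityMeasure Q]
    {U D : ℝ} (hU : 0 ≤ U) {X : Ω₁ → ℝ} {Y : Ω₂ → ℝ} (hX : Measurable X) (hY : Measurable Y)
    (hXU : ∀ ω, X ω ∈ Set.Icc 0 U) (hYU : ∀ ω, Y ω ∈ Set.Icc 0 U)
    (hD : ∀ y, |P.real {ω | X ω ≤ y} - Q.real {ω | Y ω ≤ y}| ≤ D) (t : ℝ) :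
    |∫ ω, max (X ω - t) 0 ∂P - ∫ ω, max (Y ω - t) 0 ∂Q| ≤ U * D := by
  have nonneg_case : ∀ t : ℝ, 0 ≤ t →
      |∫ ω, max (X ω - t) 0 ∂P - ∫ ω, max (Y ω - t) 0 ∂Q| ≤ U * D := by
    intro t ht
    rw [integral_max_sub_zero_eq P hX hXU ht, integral_max_sub_zero_eq Q hY hYU ht,
      ← integral_sub (integrableOn_one_sub_cdf P X t U) (integrableOn_one_sub_cdf Q Y t U),
      ← Real.norm_eq_abs]
    refine (norm_setIntegral_le_of_norm_le_const (C := D) (by simp) fun s _ => ?_).trans ?_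
    · rw [Real.norm_eq_abs, sub_sub_sub_cancel_left, abs_sub_comm]
      exact hD _
    · simp [hU, mul_comm]
  rcases le_total 0 t with ht | ht
  · exact nonneg_case t ht
  · rw [integral_max_sub_of_nonpos P hX hXU ht, integral_max_sub_of_nonpos Q hY hYU ht,
      sub_sub_sub_cancel_right]
    exact nonneg_case 0 le_rfl

lemma bddBelow_cvar {Ω : Type*} [MeasurableSpace Ω] (P : Measure Ω) [IsProbabilityMeasure P]
    {α U : ℝ} (hα : α ∈ Set.Ioc (0 : ℝ) 1) {X : Ω → ℝ} (hX : Measurable X)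
    (hXU : ∀ ω, X ω ∈ Set.Icc 0 U) :
    BddBelow (Set.range fun t : ℝ => t + (1 / α) * ∫ ω, max (X ω - t) 0 ∂P) := by
  refine ⟨0, ?_⟩
  rintro _ ⟨t, rfl⟩
  have nonneg : 0 ≤ ∫ ω, max (X ω - t) 0 ∂P := integral_nonneg fun ω => le_max_right _ _
  have neg_le : -t ≤ ∫ ω, max (X ω - t) 0 ∂P := by
    have := integral_mono (μ := P) (integrable_const (-t)) (integrable_max_sub_zero P hX hXU t)
      fun ω => le_max_of_le_left (by linarith [(hXU ω).1])
    simpa using this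
  have : 1 ≤ 1 / α := one_le_one_div hα.1 hα.2
  dsimp only
  nlinarith

lemma cvar_le_cvar_add {Ω₁ Ω₂ : Type*} [MeasurableSpace Ω₁] [MeasurableSpace Ω₂]
    (P : Measure Ω₁) (Q : Measure Ω₂) [IsProbabilityMeasure P]
    {α U C : ℝ} (hα : α ∈ Set.Ioc (0 : ℝ) 1) {X : Ω₁ → ℝ} {Y : Ω₂ → ℝ} (hX : Measurable X)
    (hXU : ∀ ω, X ω ∈ Set.Icc 0 U)
    (h : ∀ t : ℝ, ∫ ω, max (X ω - t) 0 ∂P ≤ ∫ ω, max (Y ω - t) 0 ∂Q + C) :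
    cvar P α X ≤ cvar Q α Y + (1 / α) * C := by
  rw [← sub_le_iff_le_add]
  refine le_ciInf fun t => ?_
  have h1 : cvar P α X ≤ _ := ciInf_le (bddBelow_cvar P hα hX hXU) t
  have h2 := mul_le_mul_of_nonneg_left (h t) (one_div_pos.2 hα.1).le
  linarith

/-- If `X` and `Y` take values in `[0, U]`, then the difference of their CVaRs is
bounded by `(U/α)` times the Kolmogorov (sup) distance between their CDFs. -/
theorem abs_cvar_sub_cvar_le {Ω₁ Ω₂ : Type*} [MeasurableSpace Ω₁] [MeasurableSpace Ω₂]
    (P : Measure Ω₁) (Q : Measure Ω₂) [IsProbabilityMeasure P] [IsProbabilityMeasure Q]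
    (α U : ℝ) (hα : α ∈ Set.Ioc (0 : ℝ) 1) (hU : 0 < U)
    (X : Ω₁ → ℝ) (Y : Ω₂ → ℝ) (hX : Measurable X) (hY : Measurable Y)
    (hXU : ∀ ω, X ω ∈ Set.Icc 0 U) (hYU : ∀ ω, Y ω ∈ Set.Icc 0 U) :
    |cvar P α X - cvar Q α Y| ≤
      (U / α) * ⨆ y : ℝ, |(P {ω | X ω ≤ y}).toReal - (Q {ω | Y ω ≤ y}).toReal| := by
  have bdd : BddAbove (Set.range fun y : ℝ =>
      |(P {ω | X ω ≤ y}).toReal - (Q {ω | Y ω ≤ y}).toReal|) := by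
    refine ⟨1, ?_⟩
    rintro _ ⟨y, rfl⟩
    have hP : P.real {ω | X ω ≤ y} ≤ 1 := measureReal_le_one
    have hQ : Q.real {ω | Y ω ≤ y} ≤ 1 := measureReal_le_one
    exact abs_sub_le_of_nonneg_of_le measureReal_nonneg hP measureReal_nonneg hQ
  set D := ⨆ y : ℝ, |(P {ω | X ω ≤ y}).toReal - (Q {ω | Y ω ≤ y}).toReal|
  have excess := abs_integral_max_sub_le P Q hU.le hX hY hXU hYU (D := D) fun y => le_ciSup bdd y
  have h1 := cvar_le_cvar_add P Q hα hX hXU (Y := Y) (C := U * D) fun t => by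
    linarith [(abs_le.1 (excess t)).2]
  have h2 := cvar_le_cvar_add Q P hα hY hYU (Y := X) (C := U * D) fun t => by
    linarith [(abs_le.1 (excess t)).1]
  have : U / α * D = 1 / α * (U * D) := by ring
  rw [this, abs_le]
  constructor <;> linarith
end

section
/- Under the delayed-feedback setup, if L_T ≥ 2d̄ + 1, then ∑_{τ=1}^{L_T} s̃_τ ≤ ∑_{t=1}^{L_T − 2d̄ − 1} d_t + d̄·L_T − (d̄² + d̄)/2, where s̃_τ := τ − 1 − L_{μ(τ)−1}. -/
open Finset in
/-- Ordered pairs of a finite set of naturals, counted by their larger element. -/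
theorem sum_card_filter_lt (A : Finset ℕ) :
    ∑ t ∈ A, #{s ∈ A | s < t} = ∑ i ∈ range #A, i := by
  induction A using Finset.induction_on_max with
  | empty => simp
  | insert a A ha ih =>
    have hna : a ∉ A := fun h => lt_irrefl _ (ha a h)
    rw [sum_insert hna, card_insert_of_notMem hna, sum_range_succ, ← ih, add_comm]
    congr 1
    · refine sum_congr rfl fun t ht => ?_
      rw [filter_insert, if_neg (ha t ht).not_gt]
    · rw [filter_insert, if_neg (lt_irrefl a), filter_true_of_mem ha]

open Finset in
/-- Ordered pairs of a finite set of naturals at distance at most `D`. -/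
theorem sum_card_filter_window_le (D : ℕ) (A : Finset ℕ) :
    ∑ s ∈ A, #{t ∈ A | s < t ∧ t ≤ s + D} ≤ ∑ i ∈ range #A, min i D := by
  induction A using Finset.induction_on_min with
  | empty => simp
  | insert a A ha ih =>
    have hna : a ∉ A := fun h => lt_irrefl _ (ha a h)
    rw [sum_insert hna, card_insert_of_notMem hna, sum_range_succ, add_comm]
    refine add_le_add (le_trans (le_of_eq ?_) ih) (le_min ?_ ?_)
    · refine sum_congr rfl fun s hs => ?_
      rw [filter_insert, if_neg fun h => (ha s hs).not_gt h.1]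
    · rw [filter_insert, if_neg fun h => lt_irrefl a h.1]
      exact card_filter_le _ _
    · calc _ ≤ #(Ioc a (a + D)) := card_le_card fun t ht => by
            simpa using (mem_filter.1 ht).2
        _ = D := by simp

open Finset in
theorem two_mul_sum_range_min (D k : ℕ) :
    2 * ∑ i ∈ range (D + 1 + k), min i D = D * (D + 1) + 2 * k * D := by
  induction k with
  | zero =>
    rw [add_zero, sum_congr rfl fun i hi => min_eq_left (Nat.lt_succ_iff.1 (mem_range.1 hi)),
      mul_comm, sum_range_id_mul_two]
    simp [mul_comm]
  | succ k ih =>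
    rw [← add_assoc, sum_range_succ, mul_add, ih, min_eq_right (by omega)]
    ring

open Finset in
/-- Pairs of received slots, split by whether the earlier feedback arrives before the later slot. -/
theorem sum_range_card_eq (T : ℕ) (d : ℕ → ℕ) (R : Finset ℕ)
    (hR : R = {t ∈ Icc 1 T | t + d t ≤ T}) :
    ∑ i ∈ range #R, i = ∑ t ∈ R, #{s ∈ Icc 1 T | s + d s ≤ t - 1} +
      ∑ s ∈ R, #{t ∈ R | s < t ∧ t ≤ s + d s} := by
  have hswap : ∑ s ∈ R, #{t ∈ R | s < t ∧ t ≤ s + d s} =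
      ∑ t ∈ R, #{s ∈ R | s < t ∧ t ≤ s + d s} :=
    sum_card_bipartiteAbove_eq_sum_card_bipartiteBelow fun s t => s < t ∧ t ≤ s + d s
  rw [← sum_card_filter_lt, hswap, ← sum_add_distrib]
  refine sum_congr rfl fun t ht => ?_
  rw [← card_union_of_disjoint]
  · congr 1
    ext s
    simp only [hR, mem_filter, mem_Icc, mem_union] at ht ⊢
    omega
  · refine disjoint_left.2 fun s hs hs' => ?_
    simp only [hR, mem_filter, mem_Icc] at ht hs hs'
    omega

open Finset in
theorem sum_card_overlap_le (T D : ℕ) (d : ℕ → ℕ) (hd : ∀ t, 1 ≤ t → t ≤ T → d t ≤ D)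
    (R : Finset ℕ) (hR : R = {t ∈ Icc 1 T | t + d t ≤ T}) (hcard : 2 * D + 1 ≤ #R) :
    ∑ s ∈ R, #{t ∈ R | s < t ∧ t ≤ s + d s} ≤
      ∑ t ∈ Icc 1 (#R - 2 * D - 1), d t + ∑ i ∈ range (D + 1 + D), min i D := by
  have hRT : #R ≤ T := by
    rw [hR]
    simpa using card_filter_le (Icc 1 T) fun t => t + d t ≤ T
  set m := #R - 2 * D - 1 with hm
  have hearly : {s ∈ R | s ≤ m} = Icc 1 m := by
    ext s
    simp only [hR, mem_filter, mem_Icc]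
    have := hd s
    omega
  have hlate : #{s ∈ R | ¬ s ≤ m} = D + 1 + D := by
    have h := card_filter_add_card_filter_not (s := R) (fun s => s ≤ m)
    rw [hearly, Nat.card_Icc] at h
    omega
  rw [← sum_filter_add_sum_filter_not R (fun s => s ≤ m), hearly, ← hlate]
  refine add_le_add (sum_le_sum fun s _ => ?_)
    (le_trans (sum_le_sum fun s hs => card_le_card fun t ht => ?_)
      (sum_card_filter_window_le D _))
  · calc _ ≤ #(Ioc s (s + d s)) := card_le_card fun t ht => by
          simpa using (mem_filter.1 ht).2
      _ = d s := by simp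
  · have := hd s
    simp only [hR, mem_filter, mem_Icc] at hs ht ⊢
    omega

/-- Delayed-feedback setup: feedback generated at slot `t ∈ {1,…,T}` is received at
slot `t + d t`; `L s` counts the feedbacks received by the end of slot `s`; `μ`
enumerates, sorted by reception time, the slots whose feedback arrives within the
horizon.  Second claim of Lemma 4: if `L T ≥ 2 d̄ + 1`, the cumulative reordering
offset `∑_{τ=1}^{L T} (τ - 1 - L (μ τ - 1))` is at most
`∑_{t=1}^{L T - 2 d̄ - 1} d t + d̄ · L T - (d̄² + d̄)/2`. -/
theorem sum_stilde_le (T dbar : ℕ) (hT : 1 ≤ T) (d : ℕ → ℕ)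
    (hd : ∀ t, 1 ≤ t → t ≤ T → d t ≤ dbar)
    (L : ℕ → ℕ)
    (hL : ∀ s, L s = ((Finset.Icc 1 T).filter (fun t => t + d t ≤ s)).card)
    (μ : ℕ → ℕ)
    (hμinj : Set.InjOn μ (Set.Icc 1 (L T)))
    (hμrange : μ '' Set.Icc 1 (L T) = {t | 1 ≤ t ∧ t ≤ T ∧ t + d t ≤ T})
    (hμsorted : ∀ τ τ', 1 ≤ τ → τ < τ' → τ' ≤ L T →
      μ τ + d (μ τ) ≤ μ τ' + d (μ τ'))
    (hLT : 2 * dbar + 1 ≤ L T) :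
    ∑ τ ∈ Finset.Icc 1 (L T), ((τ : ℝ) - 1 - (L (μ τ - 1) : ℝ)) ≤
      (∑ t ∈ Finset.Icc 1 (L T - 2 * dbar - 1), (d t : ℝ)) +
        (dbar : ℝ) * (L T : ℝ) - ((dbar : ℝ) ^ 2 + (dbar : ℝ)) / 2 := by
  obtain ⟨R, hR⟩ : ∃ R, R = (Finset.Icc 1 T).filter (fun t => t + d t ≤ T) := ⟨_, rfl⟩
  have hcard : R.card = L T := by rw [hR, hL]
  have himage : (Finset.Icc 1 (L T)).image μ = R := by
    apply Finset.coe_injective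
    rw [Finset.coe_image, Finset.coe_Icc, hμrange, hR]
    ext t
    simp [and_assoc]
  have hreindex : ∑ τ ∈ Finset.Icc 1 (L T), (L (μ τ - 1) : ℝ) = ∑ t ∈ R, (L (t - 1) : ℝ) := by
    rw [← himage, Finset.sum_image (by simpa using hμinj)]
  have hranks : ∑ τ ∈ Finset.Icc 1 (L T), ((τ : ℝ) - 1) =
      ((∑ i ∈ Finset.range (L T), i : ℕ) : ℝ) := by
    rw [Finset.range_eq_Ico, ← Finset.Ico_add_one_right_eq_Icc, ← zero_add 1,
      ← Finset.sum_Ico_add']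
    push_cast
    simp
  have hsplit := sum_range_card_eq T d R hR
  have hoverlap := sum_card_overlap_le T dbar d hd R hR (hcard ▸ hLT)
  have hmin := two_mul_sum_range_min dbar dbar
  simp only [← hL, hcard] at hsplit hoverlap
  rw [Finset.sum_sub_distrib, hreindex, hranks, hsplit]
  have hoverlap' := (Nat.cast_le (α := ℝ)).2 hoverlap
  have hmin' := congrArg (Nat.cast : ℕ → ℝ) hmin
  have hLT' : (2 * dbar + 1 : ℝ) ≤ L T := by exact_mod_cast hLT
  have hmul := mul_le_mul_of_nonneg_left hLT' (Nat.cast_nonneg (α := ℝ) dbar)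
  push_cast at hoverlap' hmin' ⊢
  linarith
end

section
/- Under the delayed-feedback setup, for every natural number M with M + d̄ ≤ T one has ∑_{t=1}^{M} t − ∑_{t=1}^{M + d̄} L_t ≤ ∑_{t=1}^{M} d_t. -/
theorem sum_Icc_reflect_cast (M : ℕ) :
    ∑ t ∈ Finset.Icc 1 M, ((M : ℤ) + 1 - t) = ∑ t ∈ Finset.Icc 1 M, (t : ℤ) := by
  refine Finset.sum_nbij' (fun t => M + 1 - t) (fun t => M + 1 - t) ?_ ?_ ?_ ?_ ?_ <;>
    intro t ht <;> simp only [Finset.mem_Icc] at * <;> omega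

theorem sum_card_filter_le_eq (S N : Finset ℕ) (f : ℕ → ℕ) :
    ∑ s ∈ N, (S.filter (fun t => f t ≤ s)).card =
      ∑ t ∈ S, (N.filter (fun s => f t ≤ s)).card := by
  simp only [Finset.card_filter]
  exact Finset.sum_comm

theorem sub_le_card_filter_le (N a : ℕ) (ha : 1 ≤ a) :
    (N : ℤ) + 1 - a ≤ ((Finset.Icc 1 N).filter (fun s => a ≤ s)).card := by
  have h : (Finset.Icc 1 N).filter (fun s => a ≤ s) = Finset.Icc a N := by
    ext s
    simp only [Finset.mem_filter, Finset.mem_Icc]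
    omega
  rw [h, Nat.card_Icc]
  omega


/-- Delayed-feedback setup: feedback generated at slot `t ∈ {1,…,T}` is received at
slot `t + d t`; `L s` counts the feedbacks received by the end of slot `s`.
Intermediate inequality (19) of Lemma 4: for every `M` with `M + d̄ ≤ T`,
`∑_{t=1}^M t - ∑_{t=1}^{M+d̄} L t ≤ ∑_{t=1}^M d t`. -/
theorem undercount_bound (T dbar : ℕ) (hT : 1 ≤ T) (d : ℕ → ℕ)
    (hd : ∀ t, 1 ≤ t → t ≤ T → d t ≤ dbar)
    (L : ℕ → ℕ)
    (hL : ∀ s, L s = ((Finset.Icc 1 T).filter (fun t => t + d t ≤ s)).card) :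
    ∀ M : ℕ, M + dbar ≤ T →
      (∑ t ∈ Finset.Icc 1 M, (t : ℤ)) - (∑ t ∈ Finset.Icc 1 (M + dbar), (L t : ℤ)) ≤
        ∑ t ∈ Finset.Icc 1 M, (d t : ℤ) := by
  intro M hM
  have hcount : ∑ t ∈ Finset.Icc 1 M, ((M : ℤ) + 1 - t - d t) ≤
      ∑ s ∈ Finset.Icc 1 (M + dbar), (L s : ℤ) := by
    simp only [hL]
    rw [← Nat.cast_sum, sum_card_filter_le_eq _ _ (fun t => t + d t), Nat.cast_sum]
    refine le_trans (Finset.sum_le_sum fun t ht => ?_)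
      (Finset.sum_le_sum_of_subset_of_nonneg
        (Finset.Icc_subset_Icc_right (by omega : M ≤ T)) fun _ _ _ => Nat.cast_nonneg _)
    have ht' := (Finset.mem_Icc.mp ht).1
    have := sub_le_card_filter_le (M + dbar) (t + d t) (by omega)
    push_cast at this ⊢
    linarith [Int.natCast_nonneg dbar]
  rw [Finset.sum_sub_distrib, sum_Icc_reflect_cast] at hcount
  linarith
end

section
/- Under the delayed-feedback setup, if d̄ ≤ L_T, then the set S := {τ ∈ {1, …, L_T} : μ(τ) > L_T − d̄} has exactly d̄ elements, and ∑_{τ∈S} L_{μ(τ)−1} ≥ d̄·(2·L_T − 3·d̄ − 1)/2. -/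
/-- Distinct natural numbers exceeding `N` sum to at least
`(N + 1) + (N + 2) + ⋯ + (N + k)`, where `k` is how many there are. -/
theorem Finset.card_mul_le_two_mul_sum_of_lt (N : ℕ) (s : Finset ℕ) (hs : ∀ t ∈ s, N < t) :
    s.card * (2 * N + s.card + 1) ≤ 2 * ∑ t ∈ s, t := by
  induction s using Finset.induction_on_max with
  | empty => simp
  | insert a s ha ih =>
    have ha' : a ∉ s := fun h => lt_irrefl _ (ha a h)
    have ih' := ih fun t ht => hs t (Finset.mem_insert_of_mem ht)
    have hNa : N < a := hs a (Finset.mem_insert_self a s)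
    have hsub : s ⊆ Finset.Ioo N a := fun t ht =>
      Finset.mem_Ioo.2 ⟨hs t (Finset.mem_insert_of_mem ht), ha t ht⟩
    have hcard := Finset.card_le_card hsub
    rw [Nat.card_Ioo] at hcard
    rw [Finset.card_insert_of_notMem ha', Finset.sum_insert ha']
    have : N + s.card + 1 ≤ a := by omega
    nlinarith

/-- If all delays are at most `D`, then at least `s - D` feedbacks arrive by slot `s`. -/
theorem le_card_received_add (T D : ℕ) (d : ℕ → ℕ) (hd : ∀ t, 1 ≤ t → t ≤ T → d t ≤ D)
    (s : ℕ) (hs : s ≤ T) :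
    s ≤ ((Finset.Icc 1 T).filter (fun t => t + d t ≤ s)).card + D := by
  have hsub : Finset.Icc 1 (s - D) ⊆ (Finset.Icc 1 T).filter (fun t => t + d t ≤ s) := by
    intro t ht
    rw [Finset.mem_Icc] at ht
    have := hd t ht.1 (by omega)
    simp only [Finset.mem_filter, Finset.mem_Icc]
    omega
  have := Finset.card_le_card hsub
  rw [Nat.card_Icc] at this
  omega

/-- Delayed-feedback setup: feedback generated at slot `t ∈ {1,…,T}` is received at
slot `t + d t`; `L s` counts the feedbacks received by the end of slot `s`; `μ`
enumerates, sorted by reception time, the slots whose feedback arrives within the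
horizon.  Intermediate claim (20) of Lemma 4: if `d̄ ≤ L T`, then the set
`S = {τ ∈ {1,…,L T} : μ τ > L T - d̄}` has exactly `d̄` elements and
`∑_{τ∈S} L (μ τ - 1) ≥ d̄ (2 L T - 3 d̄ - 1)/2`. -/
theorem tail_sum_bound (T dbar : ℕ) (hT : 1 ≤ T) (d : ℕ → ℕ)
    (hd : ∀ t, 1 ≤ t → t ≤ T → d t ≤ dbar)
    (L : ℕ → ℕ)
    (hL : ∀ s, L s = ((Finset.Icc 1 T).filter (fun t => t + d t ≤ s)).card)
    (μ : ℕ → ℕ)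
    (hμinj : Set.InjOn μ (Set.Icc 1 (L T)))
    (hμrange : μ '' Set.Icc 1 (L T) = {t | 1 ≤ t ∧ t ≤ T ∧ t + d t ≤ T})
    (hμsorted : ∀ τ τ', 1 ≤ τ → τ < τ' → τ' ≤ L T →
      μ τ + d (μ τ) ≤ μ τ' + d (μ τ'))
    (hdbar : dbar ≤ L T) :
    ((Finset.Icc 1 (L T)).filter (fun τ => L T - dbar < μ τ)).card = dbar ∧
      (dbar : ℝ) * (2 * (L T : ℝ) - 3 * (dbar : ℝ) - 1) / 2 ≤
        ∑ τ ∈ (Finset.Icc 1 (L T)).filter (fun τ => L T - dbar < μ τ),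
          (L (μ τ - 1) : ℝ) := by
  set R := (Finset.Icc 1 T).filter (fun t => t + d t ≤ T) with hR
  set S := (Finset.Icc 1 (L T)).filter (fun τ => L T - dbar < μ τ) with hS
  have hRcard : R.card = L T := (hL T).symm
  have hLT : L T ≤ T := by
    simpa [← hRcard] using Finset.card_filter_le (Finset.Icc 1 T) (fun t => t + d t ≤ T)
  have hSinj : Set.InjOn μ S := hμinj.mono fun τ hτ => by
    simpa using (Finset.mem_filter.1 hτ).1
  have himage : S.image μ = R.filter (fun t => L T - dbar < t) := by
    ext t
    have ht := Set.ext_iff.1 hμrange t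
    simp only [Set.mem_image, Set.mem_Icc, Set.mem_ofPred_eq] at ht
    simp only [hS, hR, Finset.mem_image, Finset.mem_filter, Finset.mem_Icc]
    constructor
    · rintro ⟨τ, ⟨hτ, hlt⟩, rfl⟩
      have := ht.1 ⟨τ, hτ, rfl⟩
      tauto
    · rintro ⟨h, hlt⟩
      obtain ⟨τ, hτ, rfl⟩ := ht.2 (by tauto)
      exact ⟨τ, ⟨hτ, hlt⟩, rfl⟩
  have hlow : R.filter (fun t => ¬ L T - dbar < t) = Finset.Icc 1 (L T - dbar) := by
    ext t
    simp only [hR, Finset.mem_filter, Finset.mem_Icc]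
    constructor
    · omega
    · intro ht
      have := hd t ht.1 (by omega)
      omega
  have hcard : S.card = dbar := by
    have hsplit := Finset.card_filter_add_card_filter_not (s := R) (fun t => L T - dbar < t)
    rw [hlow, Nat.card_Icc, ← himage, Finset.card_image_of_injOn hSinj] at hsplit
    omega
  refine ⟨hcard, ?_⟩
  have hsum := Finset.card_mul_le_two_mul_sum_of_lt (L T - dbar) (S.image μ) fun t ht => by
    rw [himage] at ht
    exact (Finset.mem_filter.1 ht).2
  rw [Finset.card_image_of_injOn hSinj, Finset.sum_image hSinj, hcard] at hsum
  have hterm : ∀ τ ∈ S, (μ τ : ℝ) - (1 + dbar) ≤ (L (μ τ - 1) : ℝ) := by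
    intro τ hτ
    have hmem : μ τ ∈ R.filter (fun t => L T - dbar < t) :=
      himage ▸ Finset.mem_image_of_mem μ hτ
    simp only [hR, Finset.mem_filter, Finset.mem_Icc] at hmem
    have h := le_card_received_add T dbar d hd (μ τ - 1) (by omega)
    rw [← hL] at h
    have h' : μ τ ≤ L (μ τ - 1) + (1 + dbar) := by omega
    have : (μ τ : ℝ) ≤ L (μ τ - 1) + (1 + dbar) := by exact_mod_cast h'
    linarith
  have hle := Finset.sum_le_sum hterm
  rw [Finset.sum_sub_distrib, Finset.sum_const, hcard, nsmul_eq_mul] at hle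
  have hsum' : (dbar : ℝ) * (2 * (L T - dbar) + dbar + 1) ≤ 2 * ∑ τ ∈ S, (μ τ : ℝ) := by
    rw [← Nat.cast_sub hdbar]
    exact_mod_cast hsum
  linarith
end

section
/- Let d ≥ 1, δ > 0, and let f : ℝ^d → ℝ be Lipschitz. Define the ball-smoothed function f̂(x) := 𝔼_{v∼ν_d}[f(x + δv)], where ν_d is the uniform probability measure on the closed unit ball of ℝ^d. Then f̂ is differentiable at every x ∈ ℝ^d, and its gradient satisfies ∇f̂(x) = (d/δ)·∫_{S^{d−1}} f(x + δu)·u dσ_{d−1}(u). -/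
open MeasureTheory Metric

/-- The uniform (normalized) probability measure on the unit sphere of `ℝ^d`,
realized as a measure on the ambient space: it is the pushforward of the
normalized Lebesgue measure on the unit ball (minus the origin) under the
radial projection `x ↦ x / ‖x‖`. -/
noncomputable def sphereUniform (d : ℕ) : Measure (EuclideanSpace ℝ (Fin d)) :=
  (volume (ball (0 : EuclideanSpace ℝ (Fin d)) 1))⁻¹ •
    Measure.map (fun x => ‖x‖⁻¹ • x)
      (volume.restrict (ball (0 : EuclideanSpace ℝ (Fin d)) 1 \ {0}))

/-- The uniform probability measure on the closed unit ball of `ℝ^d`. -/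
noncomputable def ballUniform (d : ℕ) : Measure (EuclideanSpace ℝ (Fin d)) :=
  (volume (closedBall (0 : EuclideanSpace ℝ (Fin d)) 1))⁻¹ •
    volume.restrict (closedBall (0 : EuclideanSpace ℝ (Fin d)) 1)

open Set Filter Topology Module
open scoped Pointwise

section

variable {E : Type*} [NormedAddCommGroup E] [InnerProductSpace ℝ E]

lemma norm_inv_norm_smul_le_one (v : E) : ‖‖v‖⁻¹ • v‖ ≤ 1 := by
  rw [norm_smul, norm_inv, norm_norm]
  exact inv_mul_le_one

lemma abs_inner_inv_norm_smul_le (v e : E) : |inner ℝ (‖v‖⁻¹ • v) e| ≤ ‖e‖ :=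
  (abs_real_inner_le_norm _ _).trans
    (mul_le_of_le_one_left (norm_nonneg e) (norm_inv_norm_smul_le_one v))

lemma dist_inv_norm_smul_self {v : E} (hv : v ≠ 0) : dist v (‖v‖⁻¹ • v) = |‖v‖ - 1| := by
  have hv' : ‖v‖ ≠ 0 := norm_ne_zero_iff.2 hv
  rw [dist_eq_norm]
  have : v - ‖v‖⁻¹ • v = (1 - ‖v‖⁻¹) • v := by rw [sub_smul, one_smul]
  rw [this, norm_smul, Real.norm_eq_abs, ← abs_norm v, ← abs_mul, abs_norm, sub_mul, one_mul,
    inv_mul_cancel₀ hv']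

lemma hasLineDerivAt_norm {x : E} (hx : x ≠ 0) (e : E) :
    HasLineDerivAt ℝ (fun v : E => ‖v‖) (inner ℝ (‖x‖⁻¹ • x) e) x e := by
  have h1 : HasDerivAt (fun t : ℝ => x + t • e) e 0 := by
    simpa using ((hasDerivAt_id (0 : ℝ)).smul_const e).const_add x
  have h2 := h1.norm_sq.sqrt (by simpa using hx)
  simp only [Real.sqrt_sq (norm_nonneg _), zero_smul, add_zero] at h2
  have hx' : ‖x‖ ≠ 0 := norm_ne_zero_iff.2 hx
  have h3 : inner ℝ (‖x‖⁻¹ • x) e = 2 * inner ℝ x e / (2 * ‖x‖) := by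
    rw [real_inner_smul_left]
    field_simp
  rw [h3]
  exact h2

lemma lineDeriv_max_sub_norm {x : E} (hx : x ≠ 0) {r : ℝ} (hxr : ‖x‖ ≠ r) (e : E) :
    lineDeriv ℝ (fun v : E => max 0 (r - ‖v‖)) x (-e) =
      (ball (0 : E) r).indicator (fun v => inner ℝ (‖v‖⁻¹ • v) e) x := by
  rcases lt_or_gt_of_ne hxr with h | h
  · have hev : (fun v : E => max 0 (r - ‖v‖)) =ᶠ[𝓝 x] fun v => r - ‖v‖ := by
      filter_upwards [continuous_norm.continuousAt.eventually_lt_const h] with v hv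
      exact max_eq_right (sub_nonneg.2 hv.le)
    rw [hev.lineDeriv_eq, indicator_of_mem (by simpa using h)]
    have := HasDerivAt.const_sub r (hasLineDerivAt_norm hx (-e))
    rw [inner_neg_right, neg_neg] at this
    exact HasLineDerivAt.lineDeriv this
  · have hev : (fun v : E => max 0 (r - ‖v‖)) =ᶠ[𝓝 x] fun v => 0 := by
      filter_upwards [continuous_norm.continuousAt.eventually_const_lt h] with v hv
      exact max_eq_left (sub_nonpos.2 hv.le)
    rw [hev.lineDeriv_eq, indicator_of_notMem (by simpa using h.le), lineDeriv]
    exact deriv_const _ _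

variable [FiniteDimensional ℝ E] [MeasurableSpace E] [BorelSpace E]
  (μ : Measure E) [μ.IsAddHaarMeasure]

lemma setIntegral_ball_comp_inv_norm_smul (h : E → ℝ) {r : ℝ} (hr : 0 < r) :
    ∫ v in ball (0 : E) r, h (‖v‖⁻¹ • v) ∂μ =
      r ^ finrank ℝ E * ∫ v in ball (0 : E) 1, h (‖v‖⁻¹ • v) ∂μ := by
  have key := Measure.setIntegral_comp_smul_of_pos μ (fun v : E => h (‖v‖⁻¹ • v)) (ball 0 1) hr
  have hpi (v : E) : ‖r • v‖⁻¹ • r • v = ‖v‖⁻¹ • v := by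
    rw [norm_smul, Real.norm_of_nonneg hr.le, smul_smul, mul_inv, mul_right_comm,
      inv_mul_cancel₀ hr.ne', one_mul]
  have hball : r • ball (0 : E) 1 = ball 0 r := by
    rw [_root_.smul_ball hr.ne', smul_zero, Real.norm_of_nonneg hr.le, mul_one]
  simp only [hpi, hball, smul_eq_mul] at key
  rw [key, mul_inv_cancel_left₀ (by positivity)]

lemma measureReal_ball_eq_pow_mul {r : ℝ} (hr : 0 < r) :
    μ.real (ball (0 : E) r) = r ^ finrank ℝ E * μ.real (ball (0 : E) 1) := by
  simpa using setIntegral_ball_comp_inv_norm_smul μ (fun _ => 1) hr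

lemma LipschitzWith.integral_lineDeriv_mul_max_sub_norm [Nontrivial E] {K : NNReal} {g : E → ℝ}
    (hg : LipschitzWith K g) (e : E) (r : ℝ) :
    ∫ v, lineDeriv ℝ g v e * max 0 (r - ‖v‖) ∂μ =
      ∫ v in ball (0 : E) r, inner ℝ (‖v‖⁻¹ • v) e * g v ∂μ := by
  have hψ : LipschitzWith 1 (fun v : E => max 0 (r - ‖v‖)) := by
    refine LipschitzWith.const_max (LipschitzWith.of_dist_le_mul fun v w => ?_) 0
    rw [Real.dist_eq, NNReal.coe_one, one_mul, dist_eq_norm, sub_sub_sub_cancel_left, abs_sub_comm]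
    exact abs_norm_sub_norm_le v w
  have hsupp : HasCompactSupport (fun v : E => max 0 (r - ‖v‖)) := by
    refine HasCompactSupport.intro (isCompact_closedBall (0 : E) r) fun v hv => ?_
    rw [mem_closedBall_zero_iff, not_le] at hv
    exact max_eq_left (sub_nonpos.2 hv.le)
  rw [hg.integral_lineDeriv_mul_eq hψ hsupp, ← integral_indicator measurableSet_ball]
  refine integral_congr_ae ?_
  filter_upwards [measure_eq_zero_iff_ae_notMem.1 (Measure.addHaar_sphere μ (0 : E) 0),
    measure_eq_zero_iff_ae_notMem.1 (Measure.addHaar_sphere μ (0 : E) r)] with v hv hv'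
  rw [lineDeriv_max_sub_norm (by simpa using hv) (by simpa using hv'),
    indicator_mul_left]

lemma tendsto_one_sub_pow_div_one_sub (n : ℕ) :
    Tendsto (fun r : ℝ => (1 - r)⁻¹ * (1 - r ^ n)) (𝓝[<] 1) (𝓝 n) := by
  have h : Tendsto (fun r : ℝ => ∑ i ∈ Finset.range n, r ^ i) (𝓝[<] 1) (𝓝 n) := by
    have hc : Continuous (fun r : ℝ => ∑ i ∈ Finset.range n, r ^ i) := by fun_prop
    simpa using (hc.tendsto 1).mono_left nhdsWithin_le_nhds
  refine h.congr' ?_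
  filter_upwards [self_mem_nhdsWithin] with r (hr : r < 1)
  rw [← mul_neg_geom_sum r n, inv_mul_cancel_left₀ (sub_ne_zero.2 hr.ne')]

lemma LipschitzWith.setIntegral_ball_lineDeriv [Nontrivial E] {K : NNReal} {g : E → ℝ}
    (hg : LipschitzWith K g) (e : E) :
    ∫ v in ball (0 : E) 1, lineDeriv ℝ g v e ∂μ =
      finrank ℝ E *
        ∫ v in ball (0 : E) 1, inner ℝ (‖v‖⁻¹ • v) e * g (‖v‖⁻¹ • v) ∂μ := by
  have hπ : Measurable (fun v : E => ‖v‖⁻¹ • v) := by fun_prop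
  have hw : Measurable (fun v : E => inner ℝ (‖v‖⁻¹ • v) e) := by fun_prop
  have hgm : Measurable g := hg.continuous.measurable
  have hbd (v : E) (hv : ‖v‖ ≤ 1) : |g v| ≤ |g 0| + K := by
    have h := hg.dist_le_mul v 0
    rw [Real.dist_eq, dist_zero_right] at h
    have h' : |g v| ≤ |g v - g 0| + |g 0| := by simpa using abs_add_le (g v - g 0) (g 0)
    nlinarith [K.coe_nonneg]
  have h_int {p : E → ℝ} (hp : Measurable p) (hpb : ∀ v ∈ ball (0 : E) 1, |p v| ≤ |g 0| + K) :
      IntegrableOn (fun v => inner ℝ (‖v‖⁻¹ • v) e * p v) (ball 0 1) μ := by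
    refine IntegrableOn.of_bound measure_ball_lt_top (hw.mul hp).aestronglyMeasurable
      (‖e‖ * (|g 0| + K)) ?_
    filter_upwards [ae_restrict_mem measurableSet_ball] with v hv
    rw [Real.norm_eq_abs, abs_mul]
    exact mul_le_mul (abs_inner_inv_norm_smul_le v e) (hpb v hv) (abs_nonneg _) (norm_nonneg _)
  have hi1 : IntegrableOn (fun v => inner ℝ (‖v‖⁻¹ • v) e * g v) (ball 0 1) μ :=
    h_int hgm fun v hv => hbd v (mem_ball_zero_iff.1 hv).le
  have hi2 : IntegrableOn (fun v => inner ℝ (‖v‖⁻¹ • v) e * g (‖v‖⁻¹ • v)) (ball 0 1) μ :=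
    h_int (hgm.comp hπ) fun v _ => hbd _ (norm_inv_norm_smul_le_one v)
  have hI : Ioo (0 : ℝ) 1 ∈ 𝓝[<] (1 : ℝ) := Ioo_mem_nhdsLT one_pos
  have hm (v : E) : ‖lineDeriv ℝ g v e‖ ≤ K * ‖e‖ := norm_lineDeriv_le_of_lipschitz ℝ hg
  have hψi (r : ℝ) : Integrable (fun v => lineDeriv ℝ g v e * max 0 (r - ‖v‖)) μ := by
    have hc : Continuous (fun v : E => max 0 (r - ‖v‖)) := by fun_prop
    refine (hc.integrable_of_hasCompactSupport ?_).bdd_mul (c := K * ‖e‖)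
      (aestronglyMeasurable_lineDeriv hg.continuous μ) (.of_forall hm)
    refine HasCompactSupport.intro (isCompact_closedBall (0 : E) r) fun v hv => ?_
    rw [mem_closedBall_zero_iff, not_le] at hv
    exact max_eq_left (sub_nonpos.2 hv.le)
  have T1 : Tendsto (fun r : ℝ => (1 - r)⁻¹ *
      (∫ v in ball (0 : E) 1, inner ℝ (‖v‖⁻¹ • v) e * g v ∂μ -
        ∫ v in ball (0 : E) r, inner ℝ (‖v‖⁻¹ • v) e * g v ∂μ)) (𝓝[<] 1)
      (𝓝 (∫ v in ball (0 : E) 1, lineDeriv ℝ g v e ∂μ)) := by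
    have heq (r : ℝ) : (1 - r)⁻¹ *
        (∫ v in ball (0 : E) 1, inner ℝ (‖v‖⁻¹ • v) e * g v ∂μ -
          ∫ v in ball (0 : E) r, inner ℝ (‖v‖⁻¹ • v) e * g v ∂μ) =
        ∫ v, lineDeriv ℝ g v e * ((1 - r)⁻¹ * (max 0 (1 - ‖v‖) - max 0 (r - ‖v‖))) ∂μ := by
      rw [← hg.integral_lineDeriv_mul_max_sub_norm μ e, ← hg.integral_lineDeriv_mul_max_sub_norm μ e,
        ← integral_sub (hψi 1) (hψi r), ← integral_const_mul]
      exact integral_congr_ae (.of_forall fun v => by ring)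
    simp_rw [heq]
    rw [← integral_indicator measurableSet_ball]
    refine tendsto_integral_filter_of_dominated_convergence
      ((ball (0 : E) 1).indicator fun _ => K * ‖e‖) ?_ ?_ ?_ ?_
    · refine .of_forall fun r => (aestronglyMeasurable_lineDeriv hg.continuous μ).mul ?_
      exact Continuous.aestronglyMeasurable (by fun_prop)
    · filter_upwards [hI] with r hr
      refine .of_forall fun v => ?_
      by_cases hv : v ∈ ball (0 : E) 1
      · rw [indicator_of_mem hv, norm_mul]
        have h1r : 0 < 1 - r := sub_pos.2 hr.2
        refine (mul_le_of_le_one_right (norm_nonneg _) ?_).trans (hm v)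
        rw [norm_mul, norm_inv, Real.norm_of_nonneg h1r.le, inv_mul_le_iff₀ h1r, mul_one]
        refine (abs_max_sub_max_le_max 0 (1 - ‖v‖) 0 (r - ‖v‖)).trans ?_
        rw [sub_self, abs_zero, sub_sub_sub_cancel_right, abs_of_pos h1r, max_eq_right h1r.le]
      · rw [indicator_of_notMem hv]
        rw [mem_ball_zero_iff, not_lt] at hv
        rw [max_eq_left (by linarith), max_eq_left (by linarith [hr.2])]
        simp
    · exact (integrable_indicator_iff measurableSet_ball).2
        (integrableOn_const measure_ball_lt_top.ne)
    · refine .of_forall fun v => ?_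
      refine tendsto_const_nhds.congr' ?_
      by_cases hv : v ∈ ball (0 : E) 1
      · rw [indicator_of_mem hv]
        rw [mem_ball_zero_iff] at hv
        filter_upwards [Ioo_mem_nhdsLT hv] with r hr
        rw [max_eq_right (by linarith), max_eq_right (by linarith [hr.1]),
          sub_sub_sub_cancel_right, inv_mul_cancel₀ (sub_ne_zero.2 hr.2.ne'), mul_one]
      · rw [indicator_of_notMem hv]
        rw [mem_ball_zero_iff, not_lt] at hv
        filter_upwards [hI] with r hr
        rw [max_eq_left (by linarith), max_eq_left (by linarith [hr.2])]
        simp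
  refine tendsto_nhds_unique T1 ?_
  have T3 := (tendsto_one_sub_pow_div_one_sub (finrank ℝ E)).mul_const
    (∫ v in ball (0 : E) 1, inner ℝ (‖v‖⁻¹ • v) e * g (‖v‖⁻¹ • v) ∂μ)
  refine T3.congr_dist ?_
  have T4 : Tendsto (fun r : ℝ => K * ‖e‖ * ((1 - r ^ finrank ℝ E) * μ.real (ball (0 : E) 1)))
      (𝓝[<] 1) (𝓝 0) := by
    have hc : Continuous (fun r : ℝ =>
      K * ‖e‖ * ((1 - r ^ finrank ℝ E) * μ.real (ball (0 : E) 1))) := by fun_prop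
    simpa using (hc.tendsto 1).mono_left nhdsWithin_le_nhds
  refine squeeze_zero' (.of_forall fun _ => dist_nonneg) ?_ T4
  filter_upwards [hI] with r hr
  have hsub : ball (0 : E) r ⊆ ball 0 1 := ball_subset_ball hr.2.le
  have h1r : 0 < 1 - r := sub_pos.2 hr.2
  have e2 : (1 - r ^ finrank ℝ E) *
      ∫ v in ball (0 : E) 1, inner ℝ (‖v‖⁻¹ • v) e * g (‖v‖⁻¹ • v) ∂μ =
      ∫ v in ball (0 : E) 1 \ ball 0 r, inner ℝ (‖v‖⁻¹ • v) e * g (‖v‖⁻¹ • v) ∂μ := by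
    rw [setIntegral_sdiff measurableSet_ball hi2 hsub,
      setIntegral_ball_comp_inv_norm_smul μ (fun u => inner ℝ u e * g u) hr.1]
    ring
  have e3 : (1 - r ^ finrank ℝ E) * μ.real (ball (0 : E) 1) =
      μ.real (ball (0 : E) 1 \ ball 0 r) := by
    rw [measureReal_sdiff hsub measurableSet_ball, measureReal_ball_eq_pow_mul μ hr.1]
    ring
  have hfin : μ (ball (0 : E) 1 \ ball 0 r) < ⊤ :=
    (measure_mono sdiff_subset).trans_lt measure_ball_lt_top
  have hle : ‖∫ v in ball (0 : E) 1 \ ball 0 r, (inner ℝ (‖v‖⁻¹ • v) e * g (‖v‖⁻¹ • v) -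
      inner ℝ (‖v‖⁻¹ • v) e * g v) ∂μ‖ ≤
      (‖e‖ * (K * (1 - r))) * μ.real (ball (0 : E) 1 \ ball 0 r) := by
    refine norm_setIntegral_le_of_norm_le_const hfin fun v hv => ?_
    have hv1 : ‖v‖ < 1 := mem_ball_zero_iff.1 hv.1
    have hvr : r ≤ ‖v‖ := by simpa using hv.2
    have hv0 : v ≠ 0 := norm_pos_iff.1 (hr.1.trans_le hvr)
    rw [← mul_sub, Real.norm_eq_abs, abs_mul]
    refine mul_le_mul (abs_inner_inv_norm_smul_le v e) ?_ (abs_nonneg _) (norm_nonneg _)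
    rw [← Real.dist_eq, dist_comm]
    refine (hg.dist_le_mul _ _).trans (mul_le_mul_of_nonneg_left ?_ K.coe_nonneg)
    rw [dist_inv_norm_smul_self hv0, abs_of_nonpos (by linarith)]
    linarith
  rw [← setIntegral_sdiff measurableSet_ball hi1 hsub, mul_assoc, e2, e3, Real.dist_eq, ← mul_sub,
    ← integral_sub (hi2.mono_set sdiff_subset) (hi1.mono_set sdiff_subset), abs_mul,
    abs_of_pos (inv_pos.2 h1r), inv_mul_le_iff₀ h1r]
  exact hle.trans_eq (by ring)

end

/-- One-point zeroth-order gradient identity (Flaxman et al.): the ball-smoothed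
function `f̂(x) = 𝔼_{v ∼ ball}[f(x + δ v)]` of a Lipschitz function `f` is
differentiable, with gradient `(d/δ) ∫_{S^{d-1}} f(x + δu) u dσ(u)`. -/
theorem gradient_ball_smoothed (d : ℕ) (hd : 1 ≤ d) (δ : ℝ) (hδ : 0 < δ)
    (f : EuclideanSpace ℝ (Fin d) → ℝ) (K : NNReal) (hf : LipschitzWith K f)
    (x : EuclideanSpace ℝ (Fin d)) :
    HasGradientAt (fun y => ∫ v, f (y + δ • v) ∂(ballUniform d))
      (((d : ℝ) / δ) • ∫ u, f (x + δ • u) • u ∂(sphereUniform d)) x := by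
  have : Nontrivial (EuclideanSpace ℝ (Fin d)) :=
    Module.nontrivial_of_finrank_pos (R := ℝ) (by rwa [finrank_euclideanSpace_fin])
  have hg : LipschitzWith (K * ‖δ‖₊) (fun v => f (x + δ • v)) :=
    hf.comp ((LipschitzWith.of_dist_le_mul fun v w => by
      rw [dist_add_left, dist_smul₀, coe_nnnorm]))
  set g : EuclideanSpace ℝ (Fin d) → ℝ := fun v => f (x + δ • v) with hg_def
  have hμ : ballUniform d = (volume (ball (0 : EuclideanSpace ℝ (Fin d)) 1))⁻¹ •
      volume.restrict (ball (0 : EuclideanSpace ℝ (Fin d)) 1) := by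
    rw [ballUniform, Measure.addHaar_closedBall_eq_addHaar_ball, ← closedBall_sdiff_sphere,
      Measure.restrict_congr_set (sdiff_null_ae_eq_self (Measure.addHaar_sphere _ _ _))]
  have hfin : IsFiniteMeasure (ballUniform d) := by
    rw [hμ]
    have : IsFiniteMeasure (volume.restrict (ball (0 : EuclideanSpace ℝ (Fin d)) 1)) :=
      isFiniteMeasure_restrict.2 measure_ball_lt_top.ne
    exact Measure.smul_finite _ (ENNReal.inv_ne_top.2 (measure_ball_pos _ _ one_pos).ne')
  have hac : ballUniform d ≪ volume := by
    rw [hμ]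
    exact Measure.smul_absolutelyContinuous.trans Measure.restrict_le_self.absolutelyContinuous
  have hmem : ∀ᵐ v ∂(ballUniform d), ‖v‖ ≤ 1 := by
    refine Measure.ae_smul_measure ?_ _
    filter_upwards [ae_restrict_mem measurableSet_closedBall] with v hv
    exact mem_closedBall_zero_iff.1 hv
  have hdiff : ∀ᵐ v ∂(ballUniform d), DifferentiableAt ℝ g v :=
    hac.ae_le hg.ae_differentiableAt
  have hbd (v : EuclideanSpace ℝ (Fin d)) (hv : ‖v‖ ≤ 1) :
      ‖g v‖ ≤ ‖g 0‖ + (K * ‖δ‖₊ : NNReal) := by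
    have h := hg.dist_le_mul v 0
    rw [dist_eq_norm, dist_zero_right] at h
    have h' : ‖g v‖ ≤ ‖g v - g 0‖ + ‖g 0‖ := by simpa using norm_add_le (g v - g 0) (g 0)
    nlinarith [(K * ‖δ‖₊).coe_nonneg]
  have key := hasFDerivAt_integral_of_dominated_loc_of_lip (μ := ballUniform d) (x₀ := x)
    (F := fun y v => f (y + δ • v)) (F' := fun v => δ⁻¹ • fderiv ℝ g v) (bound := fun _ => (K : ℝ))
    univ_mem
    (.of_forall fun y => (hf.continuous.comp (by fun_prop)).aestronglyMeasurable)
    (Integrable.of_bound hg.continuous.aestronglyMeasurable _ (hmem.mono hbd))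
    ((measurable_fderiv ℝ g).const_smul δ⁻¹).aestronglyMeasurable
    (.of_forall fun v => (LipschitzWith.of_dist_le_mul fun y z => by
      simpa using hf.dist_le_mul (y + δ • v) (z + δ • v)).lipschitzOnWith)
    (integrable_const _)
    (by
      filter_upwards [hdiff] with v hv
      have h1 : HasFDerivAt (fun y => v + δ⁻¹ • (y - x))
          (δ⁻¹ • ContinuousLinearMap.id ℝ (EuclideanSpace ℝ (Fin d))) x :=
        (((hasFDerivAt_id x).sub_const x).const_smul δ⁻¹).const_add v
      have h2 : HasFDerivAt g (fderiv ℝ g v) (v + δ⁻¹ • (x - x)) := by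
        simpa using hv.hasFDerivAt
      have h3 := h2.comp x h1
      have e1 : g ∘ (fun y => v + δ⁻¹ • (y - x)) = fun y => f (y + δ • v) := by
        funext y
        simp only [hg_def, Function.comp_apply, smul_add, smul_inv_smul₀ hδ.ne']
        congr 1
        abel
      rw [e1, ContinuousLinearMap.comp_smul, ContinuousLinearMap.comp_id] at h3
      exact h3)
  rw [hasGradientAt_iff_hasFDerivAt]
  refine key.2.congr_fderiv ?_
  ext1 e
  have hπ : Measurable (fun v : EuclideanSpace ℝ (Fin d) => ‖v‖⁻¹ • v) := by fun_prop
  have hgc : Continuous g := hg.continuous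
  have hsphere : ∫ u, g u • u ∂(sphereUniform d) =
      (volume (ball (0 : EuclideanSpace ℝ (Fin d)) 1))⁻¹.toReal •
        ∫ v in ball (0 : EuclideanSpace ℝ (Fin d)) 1, g (‖v‖⁻¹ • v) • ‖v‖⁻¹ • v := by
    rw [sphereUniform, integral_smul_measure, integral_map hπ.aemeasurable
      (by fun_prop : Continuous fun u => g u • u).aestronglyMeasurable,
      Measure.restrict_congr_set (sdiff_null_ae_eq_self (measure_singleton _))]
  have h_int : IntegrableOn (fun v : EuclideanSpace ℝ (Fin d) => g (‖v‖⁻¹ • v) • ‖v‖⁻¹ • v)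
      (ball 0 1) := by
    refine IntegrableOn.of_bound measure_ball_lt_top
      ((hg.continuous.measurable.comp hπ).smul hπ).aestronglyMeasurable
      (‖g 0‖ + (K * ‖δ‖₊ : NNReal)) (.of_forall fun v => ?_)
    rw [norm_smul]
    exact (mul_le_of_le_one_right (norm_nonneg _) (norm_inv_norm_smul_le_one v)).trans
      (hbd _ (norm_inv_norm_smul_le_one v))
  have hinner : inner ℝ (∫ v in ball (0 : EuclideanSpace ℝ (Fin d)) 1,
      g (‖v‖⁻¹ • v) • ‖v‖⁻¹ • v) e =
      ∫ v in ball (0 : EuclideanSpace ℝ (Fin d)) 1,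
        inner ℝ (‖v‖⁻¹ • v) e * g (‖v‖⁻¹ • v) := by
    rw [real_inner_comm, ← integral_inner h_int]
    refine integral_congr_ae (.of_forall fun v => ?_)
    simp only
    rw [real_inner_smul_right, real_inner_comm, mul_comm]
  have hline : ∫ v, (δ⁻¹ • fderiv ℝ g v) e ∂(ballUniform d) =
      ∫ v, δ⁻¹ * lineDeriv ℝ g v e ∂(ballUniform d) := by
    refine integral_congr_ae ?_
    filter_upwards [hdiff] with v hv
    rw [hv.lineDeriv_eq_fderiv]
    rfl
  have hdiv := hg.setIntegral_ball_lineDeriv volume e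
  rw [finrank_euclideanSpace_fin] at hdiv
  rw [ContinuousLinearMap.integral_apply key.1, hline, integral_const_mul, hμ,
    integral_smul_measure, hdiv, ← hinner, InnerProductSpace.toDual_apply_apply, hsphere,
    real_inner_smul_left, real_inner_smul_left, smul_eq_mul]
  ring
end
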